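/- Let G be a countable group and μ a probability measure on G with finite entropy H(μ). Let (aₖ)_{k≥0} be nonnegative reals with ∑_{k≥0} aₖ = 1 and ∑_{k≥0} k·aₖ < ∞, and set μ' = ∑_{k≥0} aₖ μ^{*k}. Then the asymptotic entropies satisfy h(μ') = (∑_{k≥0} k·aₖ)·h(μ). -/

import Mathlib

open MeasureTheory Filter Real Topology ENNReal

/-- Position of the random walk after `n` steps: `x n = h 1 ⋯ h n`, where `h : ℕ → G` is the
sequence of increments (`h i` being the `(i+1)`-st increment); `x 0 = e`. -/
def rwPos {G : Type*} [Group G] (h : ℕ → G) (n : ℕ) : G :=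
  ((List.range n).map h).prod

/-- Convolution of two (sub-probability) densities on `G`: `(f * g)(x) = ∑_h f(h) g(h⁻¹ x)`. -/
noncomputable def fconv {G : Type*} [Group G] (f g : G → ℝ≥0∞) : G → ℝ≥0∞ :=
  fun x => ∑' h : G, f h * g (h⁻¹ * x)

open scoped Classical in
/-- `n`-fold convolution power of a density, with `f^{*0} = δ_e`. -/
noncomputable def fconvPow {G : Type*} [Group G] (f : G → ℝ≥0∞) : ℕ → G → ℝ≥0∞
  | 0 => fun x => if x = 1 then 1 else 0
  | n + 1 => fconv (fconvPow f n) f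

/-- Entropy of a (sub-)probability density on a countable group:
`H(f) = -∑_g f(g) log f(g)`. -/
noncomputable def fent {G : Type*} (f : G → ℝ≥0∞) : ℝ :=
  -∑' g : G, (f g).toReal * Real.log (f g).toReal

/-- The function `x ↦ -x log x` with values in `ℝ≥0∞`, meaningful on `[0, 1]`. -/
noncomputable def ennNegMulLog (x : ℝ≥0∞) : ℝ≥0∞ := x * ENNReal.ofReal (-Real.log x.toReal)

/-- Entropy of a density, with values in `ℝ≥0∞`. -/
noncomputable def ennEnt {ι : Type*} (f : ι → ℝ≥0∞) : ℝ≥0∞ := ∑' i, ennNegMulLog (f i)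

theorem le_one_of_tsum_eq_one {ι : Type*} {f : ι → ℝ≥0∞} (hf : ∑' i, f i = 1) (i : ι) :
    f i ≤ 1 :=
  hf ▸ ENNReal.le_tsum i

theorem ennNegMulLog_eq_ofReal {x : ℝ≥0∞} (hx : x ≤ 1) :
    ennNegMulLog x = ENNReal.ofReal (-(x.toReal * Real.log x.toReal)) := by
  have hx' : x ≠ ∞ := ne_top_of_le_ne_top one_ne_top hx
  rw [ennNegMulLog, ← mul_neg, ENNReal.ofReal_mul toReal_nonneg, ENNReal.ofReal_toReal hx']

theorem mul_log_toReal_nonpos {x : ℝ≥0∞} (hx : x ≤ 1) :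
    x.toReal * Real.log x.toReal ≤ 0 :=
  mul_nonpos_of_nonneg_of_nonpos toReal_nonneg
    (Real.log_nonpos toReal_nonneg (ENNReal.toReal_mono one_ne_top hx))

theorem fent_eq_toReal_ennEnt {G : Type*} {f : G → ℝ≥0∞} (hf : ∑' g, f g = 1) :
    fent f = (ennEnt f).toReal := by
  have h1 := le_one_of_tsum_eq_one hf
  rw [fent, ennEnt, ENNReal.tsum_toReal_eq, ← tsum_neg]
  · refine tsum_congr fun g => ?_
    rw [ennNegMulLog_eq_ofReal (h1 g), ENNReal.toReal_ofReal]
    linarith [mul_log_toReal_nonpos (h1 g)]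
  · intro g
    rw [ennNegMulLog_eq_ofReal (h1 g)]
    exact ofReal_ne_top

theorem ennEnt_ne_top_of_summable {G : Type*} {f : G → ℝ≥0∞} (hf : ∑' g, f g = 1)
    (hent : Summable fun g => (f g).toReal * Real.log (f g).toReal) : ennEnt f ≠ ∞ := by
  rw [ennEnt, tsum_congr fun g => ennNegMulLog_eq_ofReal (le_one_of_tsum_eq_one hf g)]
  exact hent.neg.tsum_ofReal_ne_top

/-- The tangent line inequality for the concave function `x ↦ -x log x`. -/
theorem ennNegMulLog_add_le {x c : ℝ≥0∞} (hx : x ≤ 1) (hc0 : c ≠ 0) (hc : c ≠ ∞) :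
    ennNegMulLog x + x ≤ x * ENNReal.ofReal (-Real.log c.toReal) + c := by
  have hx' : x ≠ ∞ := ne_top_of_le_ne_top one_ne_top hx
  have key : -(x.toReal * Real.log x.toReal) + x.toReal
      ≤ x.toReal * (-Real.log c.toReal) + c.toReal := by
    have hcp := ENNReal.toReal_pos hc0 hc
    rcases eq_or_ne x 0 with rfl | h0
    · simp
    have hxp := ENNReal.toReal_pos h0 hx'
    have h := Real.log_le_sub_one_of_pos (div_pos hcp hxp)
    rw [Real.log_div hcp.ne' hxp.ne'] at h
    have h2 := mul_le_mul_of_nonneg_left h hxp.le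
    have h3 : x.toReal * (c.toReal / x.toReal - 1) = c.toReal - x.toReal := by
      field_simp
    linarith
  have h4 : x * ENNReal.ofReal (-Real.log c.toReal)
      = ENNReal.ofReal (x.toReal * (-Real.log c.toReal)) := by
    rw [ENNReal.ofReal_mul toReal_nonneg, ENNReal.ofReal_toReal hx']
  calc ennNegMulLog x + x
      = ENNReal.ofReal (-(x.toReal * Real.log x.toReal) + x.toReal) := by
        rw [ENNReal.ofReal_add (by linarith [mul_log_toReal_nonpos hx]) toReal_nonneg,
          ← ennNegMulLog_eq_ofReal hx, ENNReal.ofReal_toReal hx']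
    _ ≤ ENNReal.ofReal (x.toReal * (-Real.log c.toReal) + c.toReal) :=
        ENNReal.ofReal_le_ofReal key
    _ ≤ _ := by
        refine ENNReal.ofReal_add_le.trans ?_
        rw [h4, ENNReal.ofReal_toReal hc]

theorem tsum_mul_ennNegMulLog_le {ι : Type*} {b y : ι → ℝ≥0∞} (hb : ∑' i, b i = 1)
    (hy : ∀ i, y i ≤ 1) :
    ∑' i, b i * ennNegMulLog (y i) ≤ ennNegMulLog (∑' i, b i * y i) := by
  set c := ∑' i, b i * y i with hcdef
  have hc : c ≠ ∞ := by
    refine ne_top_of_le_ne_top one_ne_top (hb ▸ ENNReal.tsum_le_tsum fun i => ?_)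
    exact mul_le_of_le_one_right' (hy i)
  rcases eq_or_ne c 0 with h0 | h0
  · have h : ∀ i, b i * y i = 0 := ENNReal.tsum_eq_zero.1 h0
    simp [ennNegMulLog, ← mul_assoc, h]
  have h : ∑' i, b i * (ennNegMulLog (y i) + y i)
      ≤ ∑' i, b i * (y i * ENNReal.ofReal (-Real.log c.toReal) + c) :=
    ENNReal.tsum_le_tsum fun i => mul_le_mul_right (ennNegMulLog_add_le (hy i) h0 hc) _
  simp only [mul_add, ENNReal.tsum_add, ← mul_assoc, ENNReal.tsum_mul_right, hb, one_mul] at h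
  rw [← hcdef] at h
  exact (ENNReal.add_le_add_iff_right hc).1 h

theorem ennNegMulLog_tsum_le {ι : Type*} {y : ι → ℝ≥0∞} (hy : ∑' i, y i ≤ 1) :
    ennNegMulLog (∑' i, y i) ≤ ∑' i, ennNegMulLog (y i) := by
  rw [ennNegMulLog, ← ENNReal.tsum_mul_right]
  refine ENNReal.tsum_le_tsum fun i => ?_
  rcases eq_or_ne (y i) 0 with h0 | h0
  · simp [h0]
  have hs : ∑' i, y i ≠ ∞ := ne_top_of_le_ne_top one_ne_top hy
  have hi : y i ≤ ∑' i, y i := ENNReal.le_tsum i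
  refine mul_le_mul_right (ENNReal.ofReal_le_ofReal (neg_le_neg ?_)) _
  exact Real.log_le_log (ENNReal.toReal_pos h0 (ne_top_of_le_ne_top hs hi))
    (ENNReal.toReal_mono hs hi)

theorem ennNegMulLog_mul_le {x y : ℝ≥0∞} (hx : x ≤ 1) (hy : y ≤ 1) :
    ennNegMulLog (x * y) ≤ x * ennNegMulLog y + ennNegMulLog x * y := by
  rcases eq_or_ne x 0 with rfl | hx0
  · simp [ennNegMulLog]
  rcases eq_or_ne y 0 with rfl | hy0
  · simp [ennNegMulLog]
  have hxp := ENNReal.toReal_pos hx0 (ne_top_of_le_ne_top one_ne_top hx)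
  have hyp := ENNReal.toReal_pos hy0 (ne_top_of_le_ne_top one_ne_top hy)
  rw [ennNegMulLog, ENNReal.toReal_mul, Real.log_mul hxp.ne' hyp.ne', neg_add]
  calc _ ≤ x * y * (ENNReal.ofReal (-Real.log x.toReal) + ENNReal.ofReal (-Real.log y.toReal)) :=
        mul_le_mul_right ENNReal.ofReal_add_le _
    _ = _ := by simp only [ennNegMulLog]; ring

section Mixture

variable {ι G : Type*} {b : ι → ℝ≥0∞} {ν : ι → G → ℝ≥0∞}

theorem tsum_mixture (hb : ∑' i, b i = 1) (hν : ∀ i, ∑' g, ν i g = 1) :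
    ∑' g, ∑' i, b i * ν i g = 1 := by
  rw [ENNReal.tsum_comm]
  simp [ENNReal.tsum_mul_left, hν, hb]

theorem tsum_mul_ennEnt_le (hb : ∑' i, b i = 1) (hν : ∀ i, ∑' g, ν i g = 1) :
    ∑' i, b i * ennEnt (ν i) ≤ ennEnt fun g => ∑' i, b i * ν i g := by
  simp only [ennEnt, ← ENNReal.tsum_mul_left]
  rw [ENNReal.tsum_comm]
  exact ENNReal.tsum_le_tsum fun g =>
    tsum_mul_ennNegMulLog_le hb fun i => le_one_of_tsum_eq_one (hν i) g

theorem ennEnt_mixture_le (hb : ∑' i, b i = 1) (hν : ∀ i, ∑' g, ν i g = 1) :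
    (ennEnt fun g => ∑' i, b i * ν i g) ≤ ∑' i, b i * ennEnt (ν i) + ennEnt b := by
  have hm := tsum_mixture hb hν
  calc (ennEnt fun g => ∑' i, b i * ν i g)
      ≤ ∑' g, ∑' i, ennNegMulLog (b i * ν i g) :=
        ENNReal.tsum_le_tsum fun g => ennNegMulLog_tsum_le (le_one_of_tsum_eq_one hm g)
    _ ≤ ∑' g, ∑' i, (b i * ennNegMulLog (ν i g) + ennNegMulLog (b i) * ν i g) :=
        ENNReal.tsum_le_tsum fun g => ENNReal.tsum_le_tsum fun i =>
          ennNegMulLog_mul_le (le_one_of_tsum_eq_one hb i) (le_one_of_tsum_eq_one (hν i) g)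
    _ = _ := by
        rw [ENNReal.tsum_comm]
        simp only [ENNReal.tsum_add, ENNReal.tsum_mul_left, hν, mul_one, ennEnt]

end Mixture

/-- The entropy of a distribution on `ℕ` grows sublinearly in its mean. -/
theorem exists_ennEnt_le_mean {t : ℝ} (ht : 0 < t) :
    ∃ C : ℝ≥0∞, C ≠ ∞ ∧ ∀ b : ℕ → ℝ≥0∞, ∑' m, b m = 1 →
      ennEnt b ≤ ENNReal.ofReal t * (∑' m : ℕ, (m : ℝ≥0∞) * b m) + C := by
  refine ⟨∑' m : ℕ, ENNReal.ofReal (Real.exp (-t * m)), ?_, fun b hb => ?_⟩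
  · refine Summable.tsum_ofReal_ne_top ?_
    simpa [mul_comm] using Real.summable_exp_nat_mul_iff.2 (neg_lt_zero.2 ht)
  have h : ∑' m, (ennNegMulLog (b m) + b m) ≤
      ∑' m : ℕ, (ENNReal.ofReal t * ((m : ℝ≥0∞) * b m) + ENNReal.ofReal (Real.exp (-t * m))) := by
    refine ENNReal.tsum_le_tsum fun m => ?_
    refine (ennNegMulLog_add_le (c := ENNReal.ofReal (Real.exp (-t * m)))
      (le_one_of_tsum_eq_one hb m) ?_ ofReal_ne_top).trans_eq ?_
    · simpa using Real.exp_pos _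
    · rw [ENNReal.toReal_ofReal (Real.exp_pos _).le, Real.log_exp, neg_mul, neg_neg,
        ENNReal.ofReal_mul ht.le, ENNReal.ofReal_natCast]
      ring
  rw [ENNReal.tsum_add, ENNReal.tsum_add, ENNReal.tsum_mul_left] at h
  exact le_self_add.trans h

section Convolution

variable {G : Type*} [Group G]

theorem tsum_inv_mul (f : G → ℝ≥0∞) (h : G) : ∑' x, f (h⁻¹ * x) = ∑' x, f x :=
  (Equiv.mulLeft h⁻¹).tsum_eq f

theorem tsum_fconv {f g : G → ℝ≥0∞} (hf : ∑' x, f x = 1) (hg : ∑' x, g x = 1) :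
    ∑' x, fconv f g x = 1 :=
  tsum_mixture (ν := fun h x => g (h⁻¹ * x)) hf fun h => (tsum_inv_mul g h).trans hg

theorem ennEnt_fconv_le {f g : G → ℝ≥0∞} (hf : ∑' x, f x = 1) (hg : ∑' x, g x = 1) :
    ennEnt (fconv f g) ≤ ennEnt f + ennEnt g := by
  have h := ennEnt_mixture_le (ν := fun h x => g (h⁻¹ * x)) hf
    fun h => (tsum_inv_mul g h).trans hg
  have h2 (k : G) : (ennEnt fun x => g (k⁻¹ * x)) = ennEnt g :=
    tsum_inv_mul (fun x => ennNegMulLog (g x)) k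
  simp only [h2, ENNReal.tsum_mul_right, hf, one_mul] at h
  rwa [add_comm] at h

theorem fconv_assoc (f g k : G → ℝ≥0∞) : fconv (fconv f g) k = fconv f (fconv g k) := by
  funext x
  simp only [fconv, ← ENNReal.tsum_mul_left, ← ENNReal.tsum_mul_right]
  rw [ENNReal.tsum_comm]
  refine tsum_congr fun h => ?_
  rw [← (Equiv.mulLeft h).tsum_eq]
  simp [mul_assoc]

theorem fconv_one (f : G → ℝ≥0∞) (μ : G → ℝ≥0∞) : fconv f (fconvPow μ 0) = f := by
  funext x
  rw [fconv, tsum_eq_single x]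
  · simp [fconvPow]
  · intro h hh
    have : h⁻¹ * x ≠ 1 := fun e => hh (inv_mul_eq_one.1 e)
    simp [fconvPow, this]

theorem fconvPow_add (f : G → ℝ≥0∞) (m n : ℕ) :
    fconvPow f (m + n) = fconv (fconvPow f m) (fconvPow f n) := by
  induction n with
  | zero => exact (fconv_one _ f).symm
  | succ n ih => rw [← add_assoc, fconvPow, ih, fconv_assoc, fconvPow]

theorem tsum_fconvPow {f : G → ℝ≥0∞} (hf : ∑' x, f x = 1) (n : ℕ) :
    ∑' x, fconvPow f n x = 1 := by
  induction n with
  | zero => simp [fconvPow]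
  | succ n ih => exact tsum_fconv ih hf

theorem ennEnt_fconvPow_zero (f : G → ℝ≥0∞) : ennEnt (fconvPow f 0) = 0 := by
  refine ENNReal.tsum_eq_zero.2 fun x => ?_
  by_cases hx : x = 1 <;> simp [fconvPow, ennNegMulLog, hx]

theorem ennEnt_fconvPow_ne_top {f : G → ℝ≥0∞} (hf : ∑' x, f x = 1) (hfin : ennEnt f ≠ ∞)
    (n : ℕ) : ennEnt (fconvPow f n) ≠ ∞ := by
  induction n with
  | zero => simp [ennEnt_fconvPow_zero]
  | succ n ih =>
    exact ne_top_of_le_ne_top (ENNReal.add_ne_top.2 ⟨ih, hfin⟩)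
      (ennEnt_fconv_le (tsum_fconvPow hf n) hf)

theorem fconv_mixture {ι κ : Type*} (b : ι → ℝ≥0∞) (a : κ → ℝ≥0∞) (ν : ι → G → ℝ≥0∞)
    (ξ : κ → G → ℝ≥0∞) (x : G) :
    fconv (fun g => ∑' i, b i * ν i g) (fun g => ∑' j, a j * ξ j g) x =
      ∑' i, ∑' j, b i * a j * fconv (ν i) (ξ j) x := by
  calc _ = ∑' h, ∑' i, ∑' j, b i * a j * (ν i h * ξ j (h⁻¹ * x)) := by
        refine tsum_congr fun h => ?_
        rw [← ENNReal.tsum_mul_right]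
        refine tsum_congr fun i => ?_
        rw [← ENNReal.tsum_mul_left]
        exact tsum_congr fun j => by ring
    _ = _ := by
        rw [ENNReal.tsum_comm]
        refine tsum_congr fun i => ?_
        rw [ENNReal.tsum_comm]
        exact tsum_congr fun j => ENNReal.tsum_mul_left

/-- The powers of a mixture of convolution powers of `f` are again such mixtures. -/
theorem exists_fconvPow_mixture (f : G → ℝ≥0∞) {a : ℕ → ℝ≥0∞} (ha : ∑' k, a k = 1) (n : ℕ) :
    ∃ b : ℕ → ℝ≥0∞, ∑' m, b m = 1 ∧
      ∑' m : ℕ, (m : ℝ≥0∞) * b m = n * ∑' k : ℕ, (k : ℝ≥0∞) * a k ∧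
      fconvPow (fun g => ∑' k, a k * fconvPow f k g) n =
        fun g => ∑' m, b m * fconvPow f m g := by
  induction n with
  | zero =>
    refine ⟨fun m => if m = 0 then 1 else 0, by simp, by simp, ?_⟩
    funext g
    simp [fconvPow]
  | succ n ih =>
    obtain ⟨b, hb, hbE, hbf⟩ := ih
    have key (F : ℕ → ℝ≥0∞) :
        ∑' m, (∑' i, ∑' j, if i + j = m then b i * a j else 0) * F m =
          ∑' i, ∑' j, b i * a j * F (i + j) := by
      simp only [← ENNReal.tsum_mul_right]
      rw [ENNReal.tsum_comm]
      refine tsum_congr fun i => ?_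
      rw [ENNReal.tsum_comm]
      refine tsum_congr fun j => ?_
      rw [tsum_eq_single (i + j)]
      · simp
      · intro m hm
        simp [hm.symm]
    refine ⟨fun m => ∑' i, ∑' j, if i + j = m then b i * a j else 0, ?_, ?_, ?_⟩
    · simpa [ENNReal.tsum_mul_left, ha, hb] using key fun _ => 1
    · simp only [mul_comm (Nat.cast _ : ℝ≥0∞)] at hbE ⊢
      rw [key fun m => (m : ℝ≥0∞)]
      have h (i j : ℕ) : b i * a j * ((i + j : ℕ) : ℝ≥0∞) =
          b i * i * a j + b i * (a j * j) := by
        push_cast; ring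
      simp only [h, ENNReal.tsum_add, ENNReal.tsum_mul_left, ENNReal.tsum_mul_right, ha, hb, hbE]
      push_cast; ring
    · funext g
      rw [fconvPow, hbf, fconv_mixture, key fun m => fconvPow f m g]
      simp only [fconvPow_add]

/-- Asymptotic entropy of `f`, together with its description as an infimum. -/
theorem exists_tendsto_ennEnt_fconvPow {f : G → ℝ≥0∞} (hf : ∑' x, f x = 1)
    (hfin : ennEnt f ≠ ∞) :
    ∃ h : ℝ, 0 ≤ h ∧
      Tendsto (fun n : ℕ => (ennEnt (fconvPow f n)).toReal / (n : ℝ)) atTop (𝓝 h) ∧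
      ∀ n : ℕ, h * n ≤ (ennEnt (fconvPow f n)).toReal := by
  have hsub : Subadditive fun n => (ennEnt (fconvPow f n)).toReal := by
    intro m n
    have hm := ennEnt_fconvPow_ne_top hf hfin m
    have hn := ennEnt_fconvPow_ne_top hf hfin n
    simp only [← ENNReal.toReal_add hm hn, fconvPow_add]
    exact ENNReal.toReal_mono (ENNReal.add_ne_top.2 ⟨hm, hn⟩)
      (ennEnt_fconv_le (tsum_fconvPow hf m) (tsum_fconvPow hf n))
  have hbdd : BddBelow (Set.range fun n : ℕ => (ennEnt (fconvPow f n)).toReal / (n : ℝ)) :=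
    ⟨0, by rintro _ ⟨n, rfl⟩; positivity⟩
  have hlim := hsub.tendsto_lim hbdd
  refine ⟨hsub.lim, ge_of_tendsto' hlim fun n => by positivity, hlim, fun n => ?_⟩
  rcases eq_or_ne n 0 with rfl | hn
  · simp
  · have hn' : (0 : ℝ) < n := by positivity
    exact (le_div_iff₀ hn').1 (hsub.lim_le_div hbdd hn)

end Convolution

/-- A sequence with `u n / n → h` is bounded above by every affine function of slope larger
than `h`. -/
theorem exists_le_mul_add_of_tendsto_div {u : ℕ → ℝ} {h r : ℝ}
    (hu : Tendsto (fun n : ℕ => u n / (n : ℝ)) atTop (𝓝 h)) (hr : h < r) (hr0 : 0 ≤ r) :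
    ∃ C : ℝ, 0 ≤ C ∧ ∀ n : ℕ, u n ≤ r * n + C := by
  obtain ⟨N, hN⟩ := eventually_atTop.1 (hu.eventually_lt_const hr)
  refine ⟨∑ i ∈ Finset.range (N + 1), |u i|, by positivity, fun n => ?_⟩
  have hrn : 0 ≤ r * n := by positivity
  rcases lt_or_ge n (N + 1) with hn | hn
  · have := Finset.single_le_sum (f := fun i => |u i|) (fun i _ => abs_nonneg _)
      (Finset.mem_range.2 hn)
    linarith [le_abs_self (u n)]
  · have hn' : (0 : ℝ) < n := by
      have : 0 < n := by omega
      exact_mod_cast this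
    have h1 := (div_lt_iff₀ hn').1 (hN n (by omega))
    have h2 : 0 ≤ ∑ i ∈ Finset.range (N + 1), |u i| := by positivity
    linarith

/-- A sequence squeezed between `h n` and `(h + ε) n + O(1)` for all `ε` satisfies
`u n / n → h`. -/
theorem tendsto_div_of_forall_le {u : ℕ → ℝ} {h : ℝ} (hlow : ∀ n : ℕ, h * n ≤ u n)
    (hup : ∀ ε > 0, ∃ C : ℝ, ∀ n : ℕ, u n ≤ (h + ε) * n + C) :
    Tendsto (fun n : ℕ => u n / (n : ℝ)) atTop (𝓝 h) := by
  refine tendsto_order.2 ⟨fun r hr => ?_, fun r hr => ?_⟩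
  · filter_upwards [eventually_gt_atTop 0] with n hn
    have hn' : (0 : ℝ) < n := by exact_mod_cast hn
    exact hr.trans_le ((le_div_iff₀ hn').2 (hlow n))
  · obtain ⟨C, hC⟩ := hup ((r - h) / 2) (by linarith)
    have hCn : ∀ᶠ n : ℕ in atTop, C / (n : ℝ) < (r - h) / 2 :=
      (tendsto_const_div_atTop_nhds_zero_nat C).eventually_lt_const (by linarith)
    filter_upwards [eventually_gt_atTop 0, hCn] with n hn hn2
    have hn' : (0 : ℝ) < n := by exact_mod_cast hn
    rw [div_lt_iff₀ hn'] at hn2 ⊢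
    linarith [hC n]

/-- For a convex combination `μ' = ∑_k a_k μ^{*k}` with `∑_k k a_k < ∞`,
`h(μ') = (∑_k k a_k) · h(μ)`. -/
theorem asymptotic_entropy_of_convex_combination
    {G : Type*} [Group G] [Countable G]
    (μf : G → ℝ≥0∞) (hprob : ∑' g : G, μf g = 1)
    (hent : Summable fun g : G => (μf g).toReal * Real.log (μf g).toReal)
    (a : ℕ → ℝ≥0∞) (ha1 : ∑' k : ℕ, a k = 1)
    (haE : ∑' k : ℕ, (k : ℝ≥0∞) * a k ≠ ∞) :
    ∃ h : ℝ,
      Tendsto (fun n : ℕ => fent (fconvPow μf n) / (n : ℝ)) atTop (𝓝 h) ∧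
      Tendsto (fun n : ℕ =>
          fent (fconvPow (fun g : G => ∑' k : ℕ, a k * fconvPow μf k g) n) / (n : ℝ))
        atTop (𝓝 ((∑' k : ℕ, (k : ℝ≥0∞) * a k).toReal * h)) := by
  have hfin := ennEnt_ne_top_of_summable hprob hent
  obtain ⟨h, h0, hlim, hlow⟩ := exists_tendsto_ennEnt_fconvPow hprob hfin
  have hpow := tsum_fconvPow hprob
  have htop := ennEnt_fconvPow_ne_top hprob hfin
  refine ⟨h, by simpa only [fent_eq_toReal_ennEnt (hpow _)] using hlim, ?_⟩
  have hmix := tsum_fconvPow (tsum_mixture ha1 hpow)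
  simp only [fent_eq_toReal_ennEnt (hmix _)]
  choose b hb hbE hbf using exists_fconvPow_mixture μf ha1
  set E := ∑' k : ℕ, (k : ℝ≥0∞) * a k with hE
  have hupper (ε : ℝ) (hε : 0 < ε) : ∃ C : ℝ≥0∞, C ≠ ∞ ∧ ∀ n : ℕ,
      ennEnt (fconvPow (fun g => ∑' k, a k * fconvPow μf k g) n) ≤
        ENNReal.ofReal (h + ε + ε) * (n * E) + C := by
    obtain ⟨C₁, hC₁, hC₁'⟩ := exists_ennEnt_le_mean hε
    obtain ⟨C₂, hC₂, hC₂'⟩ := exists_le_mul_add_of_tendsto_div hlim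
      (lt_add_of_pos_right h hε) (by positivity)
    refine ⟨ENNReal.ofReal C₂ + C₁, by finiteness, fun n => ?_⟩
    have hm (m : ℕ) : ennEnt (fconvPow μf m) ≤
        ENNReal.ofReal (h + ε) * m + ENNReal.ofReal C₂ := by
      rw [← ENNReal.ofReal_natCast m, ← ENNReal.ofReal_mul (by positivity),
        ← ENNReal.ofReal_add (by positivity) hC₂]
      exact (ENNReal.le_ofReal_iff_toReal_le (htop m) (by positivity)).2 (hC₂' m)
    rw [hbf n]
    calc _ ≤ ∑' m, b n m * ennEnt (fconvPow μf m) + ennEnt (b n) :=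
          ennEnt_mixture_le (hb n) hpow
      _ ≤ ∑' m : ℕ, (ENNReal.ofReal (h + ε) * (m * b n m) + b n m * ENNReal.ofReal C₂) +
            (ENNReal.ofReal ε * (n * E) + C₁) := by
          refine add_le_add (ENNReal.tsum_le_tsum fun m => ?_) (hbE n ▸ hC₁' _ (hb n))
          exact (mul_le_mul_right (hm m) _).trans_eq (by ring)
      _ = _ := by
          rw [ENNReal.tsum_add, ENNReal.tsum_mul_left, ENNReal.tsum_mul_right, hb, hbE,
            ENNReal.ofReal_add (p := h + ε) (by positivity) hε.le]
          ring
  have hmixtop (n : ℕ) :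
      ennEnt (fconvPow (fun g => ∑' k, a k * fconvPow μf k g) n) ≠ ∞ := by
    obtain ⟨C, hC, hC'⟩ := hupper 1 one_pos
    exact ne_top_of_le_ne_top (by finiteness) (hC' n)
  refine tendsto_div_of_forall_le (fun n => ?_) fun ε hε => ?_
  · have hm (m : ℕ) : ENNReal.ofReal h * m ≤ ennEnt (fconvPow μf m) := by
      rw [← ENNReal.ofReal_natCast m, ← ENNReal.ofReal_mul h0]
      exact ENNReal.ofReal_le_of_le_toReal (hlow m)
    have hle : ENNReal.ofReal h * (n * E) ≤
        ennEnt (fconvPow (fun g => ∑' k, a k * fconvPow μf k g) n) := by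
      rw [hbf n, ← hbE n, ← ENNReal.tsum_mul_left]
      refine le_trans (ENNReal.tsum_le_tsum fun m => ?_) (tsum_mul_ennEnt_le (hb n) hpow)
      exact le_trans (by ring_nf; rfl) (mul_le_mul_right (hm m) (b n m))
    have := ENNReal.toReal_mono (hmixtop n) hle
    simp only [ENNReal.toReal_mul, ENNReal.toReal_ofReal h0, ENNReal.toReal_natCast] at this
    linarith
  · have hE0 : 0 ≤ E.toReal := toReal_nonneg
    set δ := ε / (2 * (E.toReal + 1)) with hδ
    have hδ0 : 0 < δ := by positivity
    obtain ⟨C, hC, hC'⟩ := hupper δ hδ0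
    refine ⟨C.toReal, fun n => ?_⟩
    have h1 := ENNReal.toReal_mono (by finiteness) (hC' n)
    rw [ENNReal.toReal_add (by finiteness) hC] at h1
    simp only [ENNReal.toReal_mul, ENNReal.toReal_natCast,
      ENNReal.toReal_ofReal (show 0 ≤ h + δ + δ by positivity)] at h1
    have h2 : 2 * δ * E.toReal ≤ ε := by
      have : 2 * δ * (E.toReal + 1) = ε := by rw [hδ]; field_simp
      linarith
    have h3 := mul_le_mul_of_nonneg_right h2 (Nat.cast_nonneg (α := ℝ) n)
    linarith
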